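/- arXiv:0712.3110 — 5 statements merged into one kernel-verified Lean document; each statement's English description precedes it below -/
import Mathlib

section
/- Let f : A → B be a k-algebra homomorphism between complete local k-algebras. If the induced map m_A/m_A^2 → m_B/m_B^2 is surjective, then f is surjective. -/
/- ## Core A : non-commutative complete local algebras -/

open scoped Pointwise

universe u v w

namespace NCDeform

variable (k : Type u) [Field k]

/-- The `m`-adic closure `⋂ n, I + mⁿ` of a (left or two-sided) ideal `I` of `A`. -/
def adicClosure {A : Type v} [Ring A] (m I : Ideal A) : Ideal A :=
  ⨅ n : ℕ, I ⊔ m ^ n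

/-- `I` is closed in the `m`-adic topology. -/
def IsAdicClosed {A : Type v} [Ring A] (m I : Ideal A) : Prop :=
  I = adicClosure m I

/-- The two-sided ideal of `A` generated by a subset `S`. -/
def twoSidedSpan {A : Type v} [Ring A] (S : Set A) : Ideal A :=
  Ideal.span {x : A | ∃ a : A, ∃ s ∈ S, ∃ b : A, x = a * s * b}

/-- A (possibly non-commutative) associative unital `k`-algebra `A` is a *complete local
`k`-algebra* with Jacobson radical `m` if: `m` is a proper two-sided ideal, every element
outside `m` is a unit (so `A` is local with Jacobson radical `m`), the natural map
`k → A/m` is an isomorphism, `m/m²` is a finite-dimensional `k`-vector space, and `A` is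
complete and separated in the `m`-adic topology (`A ≅ lim A/mⁿ`). -/
structure IsCompleteLocalAlgebra (A : Type v) [Ring A] [Algebra k A] (m : Ideal A) : Prop where
  mul_mem_right : ∀ x ∈ m, ∀ a : A, x * a ∈ m
  one_not_mem : (1 : A) ∉ m
  isUnit_of_not_mem : ∀ x : A, x ∉ m → IsUnit x
  exists_residue : ∀ a : A, ∃ c : k, a - algebraMap k A c ∈ m
  finite_cotangent : ∃ s : Finset A, (↑s : Set A) ⊆ (m : Set A) ∧
    ∀ x ∈ m, x ∈ Submodule.span k (↑s : Set A) ⊔ Submodule.restrictScalars k (m ^ 2)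
  separated : ∀ x : A, (∀ n : ℕ, x ∈ m ^ n) → x = 0
  complete : ∀ x : ℕ → A, (∀ n : ℕ, x (n + 1) - x n ∈ m ^ n) →
    ∃ a : A, ∀ n : ℕ, a - x n ∈ m ^ n

/-- An object of the category `𝒜ₖ`: an artinian local `k`-algebra with residue field `k`
(equivalently, a complete local `k`-algebra whose maximal ideal is nilpotent). -/
def IsArtinianLocalAlgebra (A : Type v) [Ring A] [Algebra k A] (m : Ideal A) : Prop :=
  IsCompleteLocalAlgebra k A m ∧ ∃ n : ℕ, m ^ n = (⊥ : Ideal A)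

/-- The residue of an element of a complete local algebra : the unique scalar `c` with
`a - c ∈ m`. -/
noncomputable def residue {A : Type v} [Ring A] [Algebra k A] {m : Ideal A}
    (h : IsCompleteLocalAlgebra k A m) (a : A) : k :=
  Classical.choose (h.exists_residue a)

/-- The dimension of the cotangent space `m/m²` of `A` as a `k`-vector space. -/
noncomputable def cotangentRank (A : Type v) [Ring A] [Algebra k A] (m : Ideal A) : ℕ :=
  Module.finrank k
    ↥((Submodule.restrictScalars k m).map (Submodule.restrictScalars k (m ^ 2)).mkQ)

end NCDeform
namespace NCDeform

theorem mem_pow_zero {R : Type*} [Ring R] (I : Ideal R) (x : R) : x ∈ I ^ 0 := by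
  rw [Submodule.pow_zero, Ideal.one_eq_top]
  exact Submodule.mem_top

section

variable {k : Type*} [Field k] {A B : Type*} [Ring A] [Algebra k A] [Ring B] [Algebra k B]
  {mA : Ideal A} {mB : Ideal B}

/-- Algebra homomorphisms between complete local algebras are local. -/
theorem IsCompleteLocalAlgebra.map_mem (hA : IsCompleteLocalAlgebra k A mA)
    (hB : IsCompleteLocalAlgebra k B mB) (f : A →ₐ[k] B) {x : A} (hx : x ∈ mA) :
    f x ∈ mB := by
  obtain ⟨c, hc⟩ := hB.exists_residue (f x)
  have hc' : f (x - algebraMap k A c) ∈ mB := by simpa using hc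
  by_cases h0 : c = 0
  · simpa [h0] using hc
  · have hunit : IsUnit (x - algebraMap k A c) := by
      refine hA.isUnit_of_not_mem _ fun h => hA.one_not_mem ?_
      have hcA : algebraMap k A c ∈ mA := by simpa using mA.sub_mem hx h
      have hmul := mA.mul_mem_left (algebraMap k A c⁻¹) hcA
      rwa [← map_mul, inv_mul_cancel₀ h0, map_one] at hmul
    obtain ⟨v, hv⟩ := (hunit.map f).exists_left_inv
    exact absurd (hv ▸ mB.mul_mem_left v hc') hB.one_not_mem

theorem map_mem_pow (f : A →ₐ[k] B) (hf : ∀ x ∈ mA, f x ∈ mB) (n : ℕ) {x : A}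
    (hx : x ∈ mA ^ n) : f x ∈ mB ^ n := by
  induction n generalizing x with
  | zero => exact mem_pow_zero mB _
  | succ n ih =>
    rw [Submodule.pow_succ] at hx ⊢
    refine Submodule.mul_induction_on hx (fun a ha b hb => ?_) fun a b ha hb => ?_
    · rw [map_mul]
      exact Submodule.mul_mem_mul (ih ha) (hf b hb)
    · rw [map_add]
      exact Submodule.add_mem _ ha hb

/-- Surjectivity on cotangent spaces gives surjectivity on all graded pieces. -/
theorem exists_mem_pow_sub_mem_pow_succ (hB : IsCompleteLocalAlgebra k B mB) (f : A →ₐ[k] B)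
    (hf : ∀ x ∈ mA, f x ∈ mB) (hsurj : ∀ y ∈ mB, ∃ x ∈ mA, y - f x ∈ mB ^ 2) (n : ℕ) {y : B}
    (hy : y ∈ mB ^ n) : ∃ x ∈ mA ^ n, y - f x ∈ mB ^ (n + 1) := by
  induction n generalizing y with
  | zero =>
    obtain ⟨c, hc⟩ := hB.exists_residue y
    refine ⟨algebraMap k A c, mem_pow_zero mA _, ?_⟩
    rwa [zero_add, Submodule.pow_one, AlgHom.commutes]
  | succ n ih =>
    rw [Submodule.pow_succ] at hy
    refine Submodule.mul_induction_on hy (fun b hb b' hb' => ?_) fun b b' hb hb' => ?_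
    · obtain ⟨x, hx, hbx⟩ := ih hb
      obtain ⟨x', hx', hbx'⟩ := hsurj b' hb'
      refine ⟨x * x', Submodule.mul_mem_mul hx hx', ?_⟩
      have key : b * b' - f (x * x') = f x * (b' - f x') + (b - f x) * b' := by
        rw [map_mul]
        noncomm_ring
      rw [key]
      refine Submodule.add_mem _ ?_ (Submodule.mul_mem_mul hbx hb')
      rw [add_assoc, Submodule.pow_add mB two_ne_zero]
      exact Submodule.mul_mem_mul (map_mem_pow f hf n hx) hbx'
    · obtain ⟨x, hx, hbx⟩ := hb
      obtain ⟨x', hx', hbx'⟩ := hb'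
      refine ⟨x + x', Submodule.add_mem _ hx hx', ?_⟩
      rw [map_add, add_sub_add_comm]
      exact Submodule.add_mem _ hbx hbx'

end

end NCDeform

/-! ### STATEMENT 2
Let `f : A → B` be a `k`-algebra homomorphism between complete local `k`-algebras.  If the
induced map `m_A/m_A² → m_B/m_B²` is surjective, then `f` is surjective. -/
theorem NCDeform.statement2 {k : Type u} [Field k] {A : Type v} {B : Type w}
    [Ring A] [Algebra k A] [Ring B] [Algebra k B] (mA : Ideal A) (mB : Ideal B)
    (hA : IsCompleteLocalAlgebra k A mA) (hB : IsCompleteLocalAlgebra k B mB)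
    (f : A →ₐ[k] B)
    (hsurj : ∀ y ∈ mB, ∃ x ∈ mA, y - f x ∈ mB ^ 2) :
    Function.Surjective f := by
  have hf : ∀ x ∈ mA, f x ∈ mB := fun x hx => hA.map_mem hB f hx
  have step : ∀ (n : ℕ) (y : B), ∃ x, y ∈ mB ^ n → x ∈ mA ^ n ∧ y - f x ∈ mB ^ (n + 1) := by
    intro n y
    by_cases hy : y ∈ mB ^ n
    · obtain ⟨x, hx⟩ := exists_mem_pow_sub_mem_pow_succ hB f hf hsurj n hy
      exact ⟨x, fun _ => hx⟩
    · exact ⟨0, fun h => absurd h hy⟩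
  choose g hg using step
  intro y
  let s : ℕ → A := fun n => Nat.rec 0 (fun n a => a + g n (y - f a)) n
  have hs_succ (n : ℕ) : s (n + 1) = s n + g n (y - f (s n)) := rfl
  have hs (n : ℕ) : y - f (s n) ∈ mB ^ n := by
    induction n with
    | zero => exact mem_pow_zero mB _
    | succ n ih =>
      rw [hs_succ, map_add, ← sub_sub]
      exact (hg n _ ih).2
  obtain ⟨a, ha⟩ := hA.complete s fun n => by
    rw [hs_succ, add_sub_cancel_left]
    exact (hg n _ (hs n)).1
  refine ⟨a, (sub_eq_zero.mp (hB.separated _ fun n => ?_)).symm⟩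
  have hfa := map_mem_pow f hf n (ha n)
  rw [map_sub] at hfa
  simpa using Submodule.sub_mem _ (hs n) hfa
end

section
/- Let I be a left ideal of T = k⟨⟨t_1,…,t_r⟩⟩ that is finitely generated as a left ideal. Then I is free as a left T-module. More precisely, any finite family f_1,…,f_n ∈ I whose images form a k-basis of I/m_T·I is a free basis of I as a left T-module. -/
/- ## Core A : non-commutative complete local algebras -/

open scoped Pointwise

universe u v w

/- ## Core B : the non-commutative formal power series ring -/

namespace NCDeform

variable (k : Type u) [Field k]

/-- `T` (with distinguished elements `t i ∈ m_T` and maximal ideal `m_T`) *is* the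
non-commutative formal power series ring `k⟪t₁, …, t_r⟫`, i.e. the `J`-adic completion of
the free associative algebra `k⟨t₁, …, t_r⟩`.  This is characterized by: `T` is a complete
local `k`-algebra, the `tᵢ` give a basis of the cotangent space `m_T/m_T²`, and `T`
satisfies the universal property of the completed free algebra: every `r`-tuple of elements
of the maximal ideal of a complete local `k`-algebra `A` comes from a unique `k`-algebra
homomorphism `T → A` (such homomorphisms are automatically continuous). -/
structure IsNCPowerSeriesRing (r : ℕ) (T : Type v) [Ring T] [Algebra k T]
    (mT : Ideal T) (t : Fin r → T) : Prop where
  complete : IsCompleteLocalAlgebra k T mT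
  t_mem : ∀ i, t i ∈ mT
  t_spans : ∀ x ∈ mT,
    x ∈ Submodule.span k (Set.range t) ⊔ Submodule.restrictScalars k (mT ^ 2)
  t_indep : ∀ c : Fin r → k, (∑ i, c i • t i) ∈ mT ^ 2 → c = 0
  universal : ∀ (A : Type v) [Ring A] [Algebra k A] (mA : Ideal A),
    IsCompleteLocalAlgebra k A mA → ∀ a : Fin r → A, (∀ i, a i ∈ mA) →
      ∃! f : T →ₐ[k] A, ∀ i, f (t i) = a i

end NCDeform
namespace NCDeform

section IdealPowers

variable {T : Type v} [Ring T] {m : Ideal T}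

theorem mem_pow_zero_s2 (x : T) : x ∈ m ^ 0 := by
  rw [Submodule.pow_zero, Ideal.one_eq_top]
  exact Submodule.mem_top

theorem pow_succ_le_self (n : ℕ) : m ^ (n + 1) ≤ m :=
  Ideal.mul_le.2 fun u _ _ hv => m.mul_mem_left u hv

theorem mul_mem_pow_add (hm : ∀ x ∈ m, ∀ a : T, x * a ∈ m) {a b : ℕ} {x y : T}
    (hx : x ∈ m ^ a) (hy : y ∈ m ^ b) : x * y ∈ m ^ (a + b) := by
  induction b generalizing y with
  | zero =>
    cases a with
    | zero => exact mem_pow_zero_s2 _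
    | succ a =>
      rw [Submodule.pow_succ] at hx
      rw [add_zero, Submodule.pow_succ]
      refine Submodule.mul_induction_on hx (fun u hu v hv => ?_) (fun u v hu hv => ?_)
      · rw [mul_assoc]
        exact Submodule.mul_mem_mul hu (hm v hv y)
      · rw [add_mul]
        exact add_mem hu hv
  | succ b ih =>
    rw [Submodule.pow_succ] at hy
    rw [← add_assoc, Submodule.pow_succ]
    refine Submodule.mul_induction_on hy (fun u hu v hv => ?_) (fun u v hu hv => ?_)
    · rw [← mul_assoc]
      exact Submodule.mul_mem_mul (ih hu) hv
    · rw [mul_add]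
      exact add_mem hu hv

theorem pow_succ_le_pow (hm : ∀ x ∈ m, ∀ a : T, x * a ∈ m) (n : ℕ) : m ^ (n + 1) ≤ m ^ n :=
  Ideal.mul_le.2 fun _ hu v _ => mul_mem_pow_add (b := 0) hm hu (mem_pow_zero_s2 v)

theorem pow_succ_le_mul_pow (n : ℕ) : m ^ (n + 1) ≤ m * m ^ n := by
  induction n with
  | zero =>
    intro x hx
    rw [zero_add, Submodule.pow_one] at hx
    simpa using Submodule.mul_mem_mul hx (mem_pow_zero_s2 (m := m) 1)
  | succ n ih =>
    intro x hx
    rw [Submodule.pow_succ] at hx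
    refine Submodule.mul_induction_on hx (fun u hu v hv => ?_) (fun u v hu hv => add_mem hu hv)
    refine Submodule.mul_induction_on (ih hu) (fun a ha b hb => ?_) (fun a b ha hb => ?_)
    · rw [mul_assoc]
      refine Submodule.mul_mem_mul ha ?_
      rw [Submodule.pow_succ]
      exact Submodule.mul_mem_mul hb hv
    · rw [add_mul]
      exact add_mem ha hb

end IdealPowers

section Residue

variable {k : Type u} [Field k] {T : Type v} [Ring T] [Algebra k T] {m : Ideal T}

theorem IsCompleteLocalAlgebra.eq_zero_of_algebraMap_mem (h : IsCompleteLocalAlgebra k T m)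
    {c : k} (hc : algebraMap k T c ∈ m) : c = 0 := by
  by_contra hne
  apply h.one_not_mem
  have := m.mul_mem_left (algebraMap k T c⁻¹) hc
  rwa [← map_mul, inv_mul_cancel₀ hne, map_one] at this

theorem sub_residue_mem (h : IsCompleteLocalAlgebra k T m) (a : T) :
    a - algebraMap k T (residue k h a) ∈ m :=
  Classical.choose_spec (h.exists_residue a)

theorem residue_eq (h : IsCompleteLocalAlgebra k T m) {a : T} {c : k}
    (hc : a - algebraMap k T c ∈ m) : residue k h a = c := by
  rw [← sub_eq_zero]
  apply h.eq_zero_of_algebraMap_mem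
  have := sub_mem hc (sub_residue_mem h a)
  rwa [sub_sub_sub_cancel_left, ← map_sub] at this

/-- The residue map of a complete local algebra as an algebra homomorphism. -/
noncomputable def residueHom (h : IsCompleteLocalAlgebra k T m) : T →ₐ[k] k where
  toFun := residue k h
  map_one' := residue_eq h (by simp)
  map_zero' := residue_eq h (by simp)
  map_add' a b := residue_eq h <| by
    have := add_mem (sub_residue_mem h a) (sub_residue_mem h b)
    rwa [← add_sub_add_comm, ← map_add] at this
  map_mul' a b := residue_eq h <| by
    have := add_mem (h.mul_mem_right _ (sub_residue_mem h a) b)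
      (m.mul_mem_left (algebraMap k T (residue k h a)) (sub_residue_mem h b))
    rwa [sub_mul, mul_sub, sub_add_sub_cancel, ← map_mul] at this
  commutes' c := residue_eq h (by simp)

theorem sub_residueHom_mem (h : IsCompleteLocalAlgebra k T m) (a : T) :
    a - algebraMap k T (residueHom h a) ∈ m :=
  sub_residue_mem h a

theorem residueHom_eq_zero_iff (h : IsCompleteLocalAlgebra k T m) {a : T} :
    residueHom h a = 0 ↔ a ∈ m := by
  refine ⟨fun ha => ?_, fun ha => residue_eq h (by simpa using ha)⟩
  simpa [ha] using sub_residueHom_mem h a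

end Residue

section FoxExtension

variable {k : Type u} [Field k] {T : Type v} [Ring T] [Algebra k T]

/-- The `T`-bimodule `T` on which `T` acts on the left through the augmentation `ε`. -/
def AugTwist (_ε : T →ₐ[k] k) : Type v := T

variable (ε : T →ₐ[k] k)

instance : AddCommGroup (AugTwist ε) := inferInstanceAs (AddCommGroup T)

instance : Module k (AugTwist ε) := inferInstanceAs (Module k T)

instance : Module Tᵐᵒᵖ (AugTwist ε) := inferInstanceAs (Module Tᵐᵒᵖ T)

instance : Module T (AugTwist ε) := Module.compHom (AugTwist ε) (ε : T →+* k)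

/-- The identity, regarded as a map onto the twisted bimodule. -/
def toAugTwist : T ≃ₗ[k] AugTwist ε := LinearEquiv.refl k T

theorem augTwist_smul (a : T) (y : AugTwist ε) : a • y = ε a • y := rfl

theorem augTwist_op_smul (a : T) (y : T) :
    MulOpposite.op a • toAugTwist ε y = toAugTwist ε (y * a) := rfl

theorem symm_augTwist_op_smul (a : T) (y : AugTwist ε) :
    (toAugTwist ε).symm (MulOpposite.op a • y) = (toAugTwist ε).symm y * a := rfl

instance : SMulCommClass T Tᵐᵒᵖ (AugTwist ε) where
  smul_comm a b y := (smul_mul_assoc (ε a) ((toAugTwist ε).symm y) b.unop).symm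

instance : IsScalarTower k T (AugTwist ε) where
  smul_assoc c a y := by
    rw [augTwist_smul, augTwist_smul, map_smul, smul_assoc]

instance : IsScalarTower k Tᵐᵒᵖ (AugTwist ε) where
  smul_assoc c b y := mul_smul_comm c ((toAugTwist ε).symm y) b.unop

/-- The square-zero extension of `T` by `AugTwist ε`; algebra maps `T → FoxExt ε` over `T` are
the left Fox derivations. -/
abbrev FoxExt : Type v := TrivSqZeroExt T (AugTwist ε)

/-- The ideal of elements of the Fox extension lying over `m`. -/
def foxIdeal (m : Ideal T) : Ideal (FoxExt ε) :=
  m.comap (TrivSqZeroExt.fstHom k T (AugTwist ε))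

theorem mem_foxIdeal {m : Ideal T} {x : FoxExt ε} : x ∈ foxIdeal ε m ↔ x.fst ∈ m := Iff.rfl

variable {ε} {m : Ideal T}

theorem mem_foxIdeal_pow_succ (hm : ∀ x ∈ m, ∀ a : T, x * a ∈ m) (hε : ∀ x ∈ m, ε x = 0)
    (n : ℕ) {x : FoxExt ε} :
    x ∈ foxIdeal ε m ^ (n + 1) ↔
      x.fst ∈ m ^ (n + 1) ∧ (toAugTwist ε).symm x.snd ∈ m ^ n := by
  constructor
  · intro hx
    induction n generalizing x with
    | zero =>
      rw [zero_add, Submodule.pow_one] at hx ⊢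
      exact ⟨hx, mem_pow_zero_s2 _⟩
    | succ n ih =>
      rw [Submodule.pow_succ] at hx
      refine Submodule.mul_induction_on hx (fun u hu v hv => ?_) (fun u v hu hv => ?_)
      · obtain ⟨h1, h2⟩ := ih hu
        refine ⟨?_, ?_⟩
        · rw [TrivSqZeroExt.fst_mul, Submodule.pow_succ]
          exact Submodule.mul_mem_mul h1 hv
        · have hu0 : ε u.fst = 0 := hε _ (pow_succ_le_self n h1)
          rw [TrivSqZeroExt.snd_mul, augTwist_smul, hu0, zero_smul, zero_add,
            symm_augTwist_op_smul, Submodule.pow_succ]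
          exact Submodule.mul_mem_mul h2 hv
      · refine ⟨add_mem hu.1 hv.1, ?_⟩
        rw [TrivSqZeroExt.snd_add, map_add]
        exact add_mem hu.2 hv.2
  · have hinl : ∀ (n : ℕ) (y : T), y ∈ m ^ n →
        (TrivSqZeroExt.inl y : FoxExt ε) ∈ foxIdeal ε m ^ n := by
      intro n
      induction n with
      | zero => exact fun _ _ => mem_pow_zero_s2 _
      | succ n ih =>
        intro y hy
        rw [Submodule.pow_succ] at hy ⊢
        refine Submodule.mul_induction_on hy (fun u hu v hv => ?_) (fun u v hu hv => ?_)
        · rw [TrivSqZeroExt.inl_mul]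
          exact Submodule.mul_mem_mul (ih u hu) hv
        · rw [TrivSqZeroExt.inl_add]
          exact add_mem hu hv
    rintro ⟨h1, h2⟩
    rw [← TrivSqZeroExt.inl_fst_add_inr_snd_eq x]
    refine add_mem (hinl _ _ h1) ?_
    have key : (TrivSqZeroExt.inr x.snd : FoxExt ε) =
        TrivSqZeroExt.inr (toAugTwist ε 1) *
          TrivSqZeroExt.inl ((toAugTwist ε).symm x.snd) := by
      rw [TrivSqZeroExt.inr_mul_inl, augTwist_op_smul, one_mul, LinearEquiv.apply_symm_apply]
    have hfox : ∀ y ∈ foxIdeal ε m, ∀ a, y * a ∈ foxIdeal ε m := fun y hy a => by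
      rw [mem_foxIdeal, TrivSqZeroExt.fst_mul]
      exact hm _ hy _
    rw [key, add_comm n 1]
    refine mul_mem_pow_add hfox ?_ (hinl _ _ h2)
    rw [Submodule.pow_one, mem_foxIdeal, TrivSqZeroExt.fst_inr]
    exact zero_mem m

theorem isCompleteLocalAlgebra_foxExt (h : IsCompleteLocalAlgebra k T m) :
    IsCompleteLocalAlgebra k (FoxExt (residueHom h)) (foxIdeal (residueHom h) m) := by
  have hpow := fun (n : ℕ) (x : FoxExt (residueHom h)) =>
    mem_foxIdeal_pow_succ (x := x) h.mul_mem_right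
      (fun x hx => (residueHom_eq_zero_iff h).2 hx) n
  refine ⟨?_, ?_, ?_, ?_, ?_, ?_, ?_⟩
  · intro x hx a
    rw [mem_foxIdeal, TrivSqZeroExt.fst_mul]
    exact h.mul_mem_right _ hx _
  · rw [mem_foxIdeal, TrivSqZeroExt.fst_one]
    exact h.one_not_mem
  · intro x hx
    rw [TrivSqZeroExt.isUnit_iff_isUnit_fst]
    exact h.isUnit_of_not_mem _ hx
  · intro a
    obtain ⟨c, hc⟩ := h.exists_residue a.fst
    exact ⟨c, hc⟩
  · classical
    obtain ⟨s, hs, hspan⟩ := h.finite_cotangent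
    refine ⟨insert (TrivSqZeroExt.inr (toAugTwist _ 1)) (s.image TrivSqZeroExt.inl), ?_, ?_⟩
    · intro x hx
      simp only [Finset.coe_insert, Finset.coe_image, Set.mem_insert_iff, Set.mem_image,
        Finset.mem_coe] at hx
      rcases hx with rfl | ⟨y, hy, rfl⟩
      · simp [mem_foxIdeal]
      · exact hs hy
    · intro x hx
      obtain ⟨y, hy, z, hz, hyz⟩ := Submodule.mem_sup.1 (hspan _ hx)
      obtain ⟨c, hc⟩ := h.exists_residue ((toAugTwist (residueHom h)).symm x.snd)
      have hy' : (TrivSqZeroExt.inl y : FoxExt (residueHom h)) ∈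
          Submodule.span k (TrivSqZeroExt.inl '' (s : Set T)) := by
        have := Submodule.mem_map_of_mem (f := (TrivSqZeroExt.inlAlgHom k T
          (AugTwist (residueHom h))).toLinearMap) hy
        rwa [Submodule.map_span] at this
      refine Submodule.mem_sup.2 ⟨TrivSqZeroExt.inl y +
        c • TrivSqZeroExt.inr (toAugTwist _ 1), ?_, x - (TrivSqZeroExt.inl y +
        c • TrivSqZeroExt.inr (toAugTwist _ 1)), ?_, by abel⟩
      · refine add_mem (Submodule.span_mono ?_ hy') (Submodule.smul_mem _ _
          (Submodule.subset_span ?_))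
        · simp
        · simp
      · rw [Submodule.restrictScalars_mem, hpow 1]
        constructor
        · have hfst : y + z = x.fst := hyz
          simpa [← hfst] using hz
        · rw [Algebra.algebraMap_eq_smul_one] at hc
          rw [Submodule.pow_one]
          simpa only [TrivSqZeroExt.snd_sub, TrivSqZeroExt.snd_add, TrivSqZeroExt.snd_inl,
            TrivSqZeroExt.snd_smul, TrivSqZeroExt.snd_inr, zero_add, map_sub, map_smul,
            LinearEquiv.symm_apply_apply] using hc
  · intro x hx
    ext
    · refine h.separated _ fun n => ?_
      cases n with
      | zero => exact mem_pow_zero_s2 _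
      | succ n => exact ((hpow n x).1 (hx _)).1
    · rw [TrivSqZeroExt.snd_zero, ← (toAugTwist (residueHom h)).symm.map_eq_zero_iff]
      exact h.separated _ fun n => ((hpow n x).1 (hx _)).2
  · intro x hx
    obtain ⟨a, ha⟩ := h.complete (fun n => (x n).fst) fun n => by
      cases n with
      | zero => exact mem_pow_zero_s2 _
      | succ n => exact ((hpow n _).1 (hx _)).1
    obtain ⟨b, hb⟩ := h.complete (fun n => (toAugTwist (residueHom h)).symm (x (n + 1)).snd)
      fun n => by
        rw [← map_sub]
        exact ((hpow n _).1 (hx _)).2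
    refine ⟨TrivSqZeroExt.inl a + TrivSqZeroExt.inr (toAugTwist _ b), fun n => ?_⟩
    cases n with
    | zero => exact mem_pow_zero_s2 _
    | succ n =>
      rw [hpow]
      exact ⟨by simpa using ha (n + 1), by simpa using hb n⟩

end FoxExtension

section PowerSeries

variable {k : Type u} [Field k] {T : Type v} [Ring T] [Algebra k T] {r : ℕ} {m : Ideal T}
  {t : Fin r → T}

/-- Left Fox derivatives detect the coefficients of a right combination of the variables. -/
theorem IsNCPowerSeriesRing.eq_zero_of_sum_mul_eq_zero (h : IsNCPowerSeriesRing k r T m t)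
    {y : Fin r → T} (hy : ∑ i, t i * y i = 0) : y = 0 := by
  classical
  funext i
  set ε := residueHom h.complete with hε
  obtain ⟨f, hf, -⟩ := h.universal (FoxExt ε) (foxIdeal ε m)
    (isCompleteLocalAlgebra_foxExt h.complete)
    (fun j => TrivSqZeroExt.inl (t j) + TrivSqZeroExt.inr (toAugTwist ε (if j = i then 1 else 0)))
    (fun j => by simpa [mem_foxIdeal] using h.t_mem j)
  have hfst : (TrivSqZeroExt.fstHom k T (AugTwist ε)).comp f = AlgHom.id k T :=
    (h.universal T m h.complete t h.t_mem).unique (fun j => by simp [hf]) (fun j => rfl)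
  have hfst' (x : T) : (f x).fst = x := DFunLike.congr_fun hfst x
  have hterm (j : Fin r) : (toAugTwist ε).symm (f (t j * y j)).snd = if j = i then y j else 0 := by
    have ht : ε (t j) = 0 := (residueHom_eq_zero_iff _).2 (h.t_mem j)
    rw [map_mul, TrivSqZeroExt.snd_mul, augTwist_smul, hfst', hfst', ht, zero_smul, zero_add,
      symm_augTwist_op_smul, hf]
    simp
  have := congrArg (fun x => (toAugTwist ε).symm (f x).snd) hy
  simp only [map_sum, TrivSqZeroExt.snd_sum, hterm, map_zero, TrivSqZeroExt.snd_zero] at this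
  simpa using this

theorem IsNCPowerSeriesRing.exists_sum_mul_sub_mem (h : IsNCPowerSeriesRing k r T m t) (n : ℕ)
    {x : T} (hx : x ∈ m ^ (n + 1)) :
    ∃ y : Fin r → T, (∀ i, y i ∈ m ^ n) ∧ x - ∑ i, t i * y i ∈ m ^ (n + 2) := by
  refine Submodule.mul_induction_on (pow_succ_le_mul_pow n hx) (fun u hu v hv => ?_) ?_
  · obtain ⟨p, hp, q, hq, rfl⟩ := Submodule.mem_sup.1 (h.t_spans u hu)
    obtain ⟨c, rfl⟩ := (Submodule.mem_span_range_iff_exists_fun k).1 hp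
    refine ⟨fun i => c i • v, fun i => ?_, ?_⟩
    · change c i • v ∈ m ^ n
      rw [Algebra.smul_def]
      exact Ideal.mul_mem_left _ _ hv
    · have := mul_mem_pow_add h.complete.mul_mem_right hq hv
      simpa [add_mul, Finset.sum_mul, add_comm] using this
  · rintro u v ⟨y, hy, hy'⟩ ⟨z, hz, hz'⟩
    refine ⟨fun i => y i + z i, fun i => add_mem (hy i) (hz i), ?_⟩
    have := add_mem hy' hz'
    simpa only [mul_add, Finset.sum_add_distrib, add_sub_add_comm] using this

/-- Every element of the maximal ideal is a right linear combination of the variables. -/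
theorem IsNCPowerSeriesRing.exists_eq_sum_mul (h : IsNCPowerSeriesRing k r T m t)
    {x : T} (hx : x ∈ m) : ∃ y : Fin r → T, x = ∑ i, t i * y i := by
  choose! d hd hd' using fun (n : ℕ) (z : T) (hz : z ∈ m ^ (n + 1)) =>
    h.exists_sum_mul_sub_mem n hz
  let s : ℕ → Fin r → T := fun n => n.rec 0 fun n y => y + d n (x - ∑ i, t i * y i)
  have hs0 : s 0 = 0 := rfl
  have hs (n : ℕ) : s (n + 1) = s n + d n (x - ∑ i, t i * s n i) := rfl
  have hrem (n : ℕ) : x - ∑ i, t i * s n i ∈ m ^ (n + 1) := by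
    induction n with
    | zero =>
      rw [zero_add, Submodule.pow_one]
      simpa [hs0] using hx
    | succ n ih =>
      have := hd' n _ ih
      rwa [sub_sub, ← Finset.sum_add_distrib, Finset.sum_congr rfl
        fun i _ => (mul_add (t i) _ _).symm] at this
  choose y hy using fun i => h.complete.complete (fun n => s n i) fun n => by
    simpa [hs] using hd n _ (hrem n) i
  refine ⟨y, sub_eq_zero.1 (h.complete.separated _ fun n => ?_)⟩
  have : x - ∑ i, t i * y i = (x - ∑ i, t i * s n i) - ∑ i, t i * (y i - s n i) := by
    simp [mul_sub]
  rw [this]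
  refine sub_mem (pow_succ_le_pow h.complete.mul_mem_right n (hrem n))
    (sum_mem fun i _ => Ideal.mul_mem_left _ _ (hy i n))

/-- If every left relation between the `f j` has coefficients in the maximal ideal, then the
`f j` are left linearly independent. -/
theorem IsNCPowerSeriesRing.linearIndependent (h : IsNCPowerSeriesRing k r T m t)
    {ι : Type*} [Fintype ι] {f : ι → T}
    (hf : ∀ a : ι → T, ∑ j, a j * f j = 0 → ∀ j, a j ∈ m) : LinearIndependent T f := by
  have key (n : ℕ) : ∀ a : ι → T, ∑ j, a j * f j = 0 → ∀ j, a j ∈ m ^ n := by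
    induction n with
    | zero => exact fun _ _ _ => mem_pow_zero_s2 _
    | succ n ih =>
      intro a ha
      choose b hb using fun j => h.exists_eq_sum_mul (hf a ha j)
      have hrel : ∑ i, t i * ∑ j, b j i * f j = 0 := by
        rw [← ha]
        simp_rw [Finset.mul_sum]
        rw [Finset.sum_comm]
        refine Finset.sum_congr rfl fun j _ => ?_
        rw [hb j, Finset.sum_mul]
        exact Finset.sum_congr rfl fun i _ => (mul_assoc _ _ _).symm
      have hb' (i : Fin r) := ih (fun j => b j i)
        (congrFun (h.eq_zero_of_sum_mul_eq_zero hrel) i)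
      intro j
      rw [hb j]
      refine sum_mem fun i _ => ?_
      rw [add_comm]
      exact mul_mem_pow_add h.complete.mul_mem_right
        (by simpa only [Submodule.pow_one] using h.t_mem i) (hb' i j)
  rw [Fintype.linearIndependent_iff]
  exact fun a ha j => h.complete.separated _ fun n => key n a ha j

/-- A generating family of minimal cardinality of a left ideal is a basis of it. -/
theorem IsNCPowerSeriesRing.free_of_fg (h : IsNCPowerSeriesRing k r T m t)
    {I : Ideal T} (hI : I.FG) : Module.Free T I := by
  classical
  have hex : ∃ n, ∃ s : Finset T, s.card = n ∧ Ideal.span (s : Set T) = I :=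
    hI.elim fun s hs => ⟨_, s, rfl, hs⟩
  obtain ⟨s, hcard, rfl⟩ := Nat.find_spec hex
  have hli : LinearIndependent T (Subtype.val : s → T) := by
    refine h.linearIndependent fun a ha j => ?_
    by_contra hj
    obtain ⟨u, hu⟩ := h.complete.isUnit_of_not_mem _ hj
    have hmem : (j : T) ∈ Ideal.span ((s.erase j : Finset T) : Set T) := by
      have hj' : (j : T) = -(↑u⁻¹ * ∑ i ∈ Finset.univ.erase j, a i * i) := by
        rw [← Finset.add_sum_erase _ _ (Finset.mem_univ j)] at ha
        rw [← mul_neg, ← eq_neg_of_add_eq_zero_left ha, ← hu, Units.inv_mul_cancel_left]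
      have hsum : ↑u⁻¹ * ∑ i ∈ Finset.univ.erase j, a i * (i : T) ∈
          Ideal.span ((s.erase j : Finset T) : Set T) := by
        refine Ideal.mul_mem_left _ _ (sum_mem fun i hi => Ideal.mul_mem_left _ _
          (Ideal.subset_span ?_))
        simp only [Finset.coe_erase, Set.mem_sdiff, Finset.mem_coe, Set.mem_singleton_iff]
        exact ⟨i.2, fun hij => (Finset.mem_erase.1 hi).1 (Subtype.ext hij)⟩
      simpa only [← hj'] using neg_mem hsum
    refine Nat.find_min hex (m := (s.erase j).card) ?_ ⟨s.erase j, rfl, ?_⟩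
    · rw [← hcard]
      exact Finset.card_erase_lt_of_mem j.2
    · refine le_antisymm (Ideal.span_mono (by simp)) (Ideal.span_le.2 fun x hx => ?_)
      by_cases hxj : x = j
      · exact hxj ▸ hmem
      · exact Ideal.subset_span (by simpa [hxj] using hx)
  have := Module.Free.of_basis (Module.Basis.span hli)
  rwa [show Set.range (Subtype.val : s → T) = (s : Set T) by simp] at this

end PowerSeries

section Nakayama

variable {k : Type u} [Field k] {T : Type v} [Ring T] [Algebra k T] {m : Ideal T}

theorem IsCompleteLocalAlgebra.le_jacobson (h : IsCompleteLocalAlgebra k T m) :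
    m ≤ Ring.jacobson T := by
  rw [Ring.jacobson_eq_sInf_isMaximal]
  refine le_sInf fun M (hM : M.IsMaximal) => ?_
  have hle : M ≤ m := fun x hx => by
    by_contra hxm
    exact hM.ne_top (Ideal.eq_top_of_isUnit_mem _ hx (h.isUnit_of_not_mem x hxm))
  exact (hM.eq_of_le ((Ideal.ne_top_iff_one m).2 h.one_not_mem) hle).ge

theorem IsCompleteLocalAlgebra.le_of_le_sup_smul (h : IsCompleteLocalAlgebra k T m)
    {I N : Ideal T} (hI : I.FG) (hle : I ≤ N ⊔ m • I) : I ≤ N := by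
  have hmap : Submodule.map N.mkQ I = ⊥ := by
    refine (Submodule.FG.map N.mkQ hI).eq_bot_of_le_jacobson_smul ?_
    rw [← Submodule.map_smul'']
    have := Submodule.map_mono (f := N.mkQ) hle
    rw [Submodule.map_sup, Submodule.mkQ_map_self, bot_sup_eq] at this
    exact this.trans (Submodule.map_mono (Submodule.smul_mono_left h.le_jacobson))
  rwa [← le_bot_iff, Submodule.map_le_iff_le_comap, Submodule.comap_bot,
    Submodule.ker_mkQ] at hmap

end Nakayama

end NCDeform

/-! ### STATEMENT 3
Let `I` be a finitely generated left ideal of `T = k⟪t₁,…,t_r⟫`.  Then `I` is free as a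
left `T`-module.  More precisely, any finite family `f₁,…,f_n ∈ I` whose images form a
`k`-basis of `I/m_T·I` is a free basis of `I` as a left `T`-module (i.e. every element of
`I` is uniquely a left `T`-linear combination of the `f j`). -/
theorem NCDeform.statement3 {k : Type u} [Field k] {T : Type v} [Ring T] [Algebra k T]
    {r : ℕ} (mT : Ideal T) (t : Fin r → T) (hT : IsNCPowerSeriesRing k r T mT t)
    (I : Ideal T) (hfg : I.FG) :
    Module.Free T ↥I ∧
    ∀ (n : ℕ) (f : Fin n → T), (∀ j, f j ∈ I) →
      (∀ x ∈ I, ∃ c : Fin n → k, x - ∑ j, c j • f j ∈ mT • I) →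
      (∀ c : Fin n → k, (∑ j, c j • f j) ∈ mT • I → c = 0) →
      ∀ x ∈ I, ∃! a : Fin n → T, x = ∑ j, a j * f j := by
  refine ⟨hT.free_of_fg hfg, fun n f hfI hspan hind x hx => ?_⟩
  have hli : LinearIndependent T f := by
    refine hT.linearIndependent fun a ha j => ?_
    rw [← residueHom_eq_zero_iff hT.complete]
    refine congrFun (hind (fun j => residueHom hT.complete (a j)) ?_) j
    have hsum : ∑ j, residueHom hT.complete (a j) • f j =
        -∑ j, (a j - algebraMap k T (residueHom hT.complete (a j))) • f j := by
      simp [sub_mul, ha, Algebra.smul_def]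
    rw [hsum]
    exact neg_mem (sum_mem fun j _ =>
      Submodule.smul_mem_smul (sub_residueHom_mem hT.complete (a j)) (hfI j))
  have hgen : I ≤ Submodule.span T (Set.range f) := by
    refine hT.complete.le_of_le_sup_smul hfg fun y hy => ?_
    obtain ⟨c, hc⟩ := hspan y hy
    refine Submodule.mem_sup.2 ⟨∑ j, c j • f j, sum_mem fun j _ => ?_, _, hc, by abel⟩
    rw [Algebra.smul_def]
    exact Submodule.smul_mem _ _ (Submodule.subset_span (Set.mem_range_self j))
  obtain ⟨a, ha⟩ := (Submodule.mem_span_range_iff_exists_fun T).1 (hgen hx)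
  refine ⟨a, ha.symm, fun b hb => ?_⟩
  have hba : ∑ j, (b j - a j) • f j = 0 := by
    simp_rw [sub_smul, Finset.sum_sub_distrib, smul_eq_mul, ← hb, ← ha, smul_eq_mul, sub_self]
  exact funext fun j => sub_eq_zero.1
    (Fintype.linearIndependent_iff.1 hli (fun j => b j - a j) hba j)
end

section
/- Let I be a left ideal of a complete local k-algebra A. Then I is closed in each of the following two cases: (a) A is a non-commutative formal power series ring T = k⟨⟨t_1,…,t_r⟩⟩ and I is finitely generated as a left ideal; (b) I has finite length as a left A-module, i.e. dim_k I < ∞. -/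
/- ## Core A : non-commutative complete local algebras -/

open scoped Pointwise

universe u v w

namespace NCDeform

namespace IsCompleteLocalAlgebra

variable {k : Type u} [Field k] {A : Type v} [Ring A] [Algebra k A] {m : Ideal A}

theorem isTwoSided (h : IsCompleteLocalAlgebra k A m) : m.IsTwoSided :=
  ⟨fun {a} b ha => h.mul_mem_right a ha b⟩

theorem exists_fg_pow_le_sup_pow_succ (h : IsCompleteLocalAlgebra k A m) (n : ℕ) :
    ∃ W : Submodule k A, W.FG ∧
      (m ^ n).restrictScalars k ≤ W ⊔ (m ^ (n + 1)).restrictScalars k := by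
  have := h.isTwoSided
  induction n with
  | zero =>
    refine ⟨1, Submodule.one_eq_span (R := k) (A := A) ▸ Submodule.fg_span_singleton 1,
      fun x _ => ?_⟩
    obtain ⟨c, hc⟩ := h.exists_residue x
    refine Submodule.mem_sup.2 ⟨algebraMap k A c, Submodule.algebraMap_mem c, _, ?_,
      add_sub_cancel _ x⟩
    rwa [Submodule.restrictScalars_mem, zero_add, Submodule.pow_one]
  | succ n ih =>
    obtain ⟨W, hW, hle⟩ := ih
    obtain ⟨s, hs, hspan⟩ := h.finite_cotangent
    have hsm : Submodule.span k (s : Set A) ≤ m.restrictScalars k := Submodule.span_le.2 hs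
    refine ⟨W * Submodule.span k (s : Set A), hW.mul ⟨s, rfl⟩, fun x hx => ?_⟩
    rw [Submodule.restrictScalars_mem, Submodule.pow_succ] at hx
    refine Submodule.smul_induction_on hx (fun a ha b hb => ?_) fun _ _ => Submodule.add_mem _
    obtain ⟨w, hw, a', ha', rfl⟩ := Submodule.mem_sup.1 (hle ha)
    obtain ⟨v, hv, b', hb', rfl⟩ := Submodule.mem_sup.1 (hspan b hb)
    refine Submodule.mem_sup.2 ⟨w * v, Submodule.mul_mem_mul hw hv,
      a' * v + (w + a') * b', Submodule.add_mem _ ?_ ?_, ?_⟩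
    · rw [Submodule.restrictScalars_mem, Submodule.pow_succ]
      exact Ideal.mul_mem_mul ha' (hsm hv)
    · rw [Submodule.restrictScalars_mem, add_assoc, Ideal.IsTwoSided.pow_add]
      exact Ideal.mul_mem_mul ha hb'
    · simp only [smul_eq_mul, add_mul, mul_add]
      abel

theorem exists_fg_sup_pow_eq_top (h : IsCompleteLocalAlgebra k A m) (n : ℕ) :
    ∃ F : Submodule k A, F.FG ∧ F ⊔ (m ^ n).restrictScalars k = ⊤ := by
  induction n with
  | zero =>
    refine ⟨⊥, Submodule.fg_bot, ?_⟩
    rw [Submodule.pow_zero, Ideal.one_eq_top, Submodule.restrictScalars_top, sup_top_eq]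
  | succ n ih =>
    obtain ⟨F, hF, htop⟩ := ih
    obtain ⟨W, hW, hle⟩ := h.exists_fg_pow_le_sup_pow_succ n
    refine ⟨F ⊔ W, hF.sup hW, top_le_iff.1 ?_⟩
    rw [← htop, sup_assoc]
    exact sup_le_sup_left hle F

theorem isArtinian_quotient_pow (h : IsCompleteLocalAlgebra k A m) (n : ℕ) :
    IsArtinian A (A ⧸ m ^ n) := by
  obtain ⟨F, hF, htop⟩ := h.exists_fg_sup_pow_eq_top n
  let π : A →ₗ[k] A ⧸ m ^ n := (m ^ n).mkQ.restrictScalars k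
  have hmap : F.map π = ⊤ := by
    refine eq_top_iff.2 fun y _ => ?_
    obtain ⟨x, rfl⟩ := (m ^ n).mkQ_surjective y
    obtain ⟨f, hf, z, hz, rfl⟩ := Submodule.mem_sup.1 (htop ▸ Submodule.mem_top : x ∈ _)
    refine ⟨f, hf, (Submodule.Quotient.eq _).2 ?_⟩
    simpa using hz
  have : Module.Finite k (A ⧸ m ^ n) := ⟨hmap ▸ hF.map π⟩
  exact isArtinian_of_tower k inferInstance

/-- A descending chain of submodules of a finite free module is eventually constant modulo
each power of the maximal ideal. -/
theorem exists_forall_le_sup_pi_pow (h : IsCompleteLocalAlgebra k A m) {s : ℕ}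
    {K : ℕ → Submodule A (Fin s → A)} (hK : Antitone K) (n : ℕ) :
    ∃ N, ∀ M, K N ≤ K M ⊔ Submodule.pi Set.univ fun _ => m ^ n := by
  have := h.isArtinian_quotient_pow n
  let ψ : (Fin s → A) →ₗ[A] (Fin s → A ⧸ m ^ n) := (m ^ n).mkQ.compLeft (Fin s)
  obtain ⟨N, hN⟩ := IsArtinian.monotone_stabilizes
    (⟨fun i => OrderDual.toDual ((K i).map ψ), fun i j hij => Submodule.map_mono (hK hij)⟩ :
      ℕ →o (Submodule A (Fin s → A ⧸ m ^ n))ᵒᵈ)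
  refine ⟨N, fun M a ha => ?_⟩
  rcases le_total M N with hM | hM
  · exact Submodule.mem_sup_left (hK hM ha)
  have hmap : (K N).map ψ = (K M).map ψ := hN M hM
  obtain ⟨b, hb, hab⟩ : ψ a ∈ (K M).map ψ := hmap ▸ Submodule.mem_map_of_mem ha
  refine Submodule.mem_sup.2 ⟨b, hb, a - b, fun i _ => ?_, add_sub_cancel b a⟩
  exact (Submodule.Quotient.eq _).1 (congrFun hab i).symm

theorem map_mem_pow (h : IsCompleteLocalAlgebra k A m) {s : ℕ} (φ : (Fin s → A) →ₗ[A] A)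
    {n : ℕ} {a : Fin s → A} (ha : ∀ i, a i ∈ m ^ n) : φ a ∈ m ^ n := by
  have := h.isTwoSided
  rw [LinearMap.pi_apply_eq_sum_univ φ a]
  exact Submodule.sum_mem _ fun i _ => Ideal.mul_mem_right _ _ (ha i)

/-- Every finitely generated left ideal of a complete local algebra is closed. -/
theorem isAdicClosed_of_fg (h : IsCompleteLocalAlgebra k A m) {I : Ideal A} (hI : I.FG) :
    IsAdicClosed m I := by
  have := h.isTwoSided
  refine le_antisymm (le_iInf fun n => le_sup_left) fun x hx => ?_
  obtain ⟨s, φ, rfl⟩ := (Submodule.fg_iff_exists_fin_linearMap A A).1 hI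
  have happrox (n : ℕ) : ∃ a, φ a - x ∈ m ^ n := by
    obtain ⟨_, ⟨a, rfl⟩, z, hz, rfl⟩ := Submodule.mem_sup.1 ((Submodule.mem_iInf _).1 hx n)
    exact ⟨a, by simpa using hz⟩
  have hK : Antitone fun n => Submodule.comap φ (m ^ n) :=
    fun i j hij => Submodule.comap_mono (Ideal.pow_le_pow_right hij)
  choose ν hν using fun n => h.exists_forall_le_sup_pi_pow hK n
  let μ (n : ℕ) : ℕ := n + ∑ i ∈ Finset.range (n + 1), ν i
  have hμ (n : ℕ) : ν n ≤ μ n :=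
    (Finset.single_le_sum (fun _ _ => Nat.zero_le _) (Finset.self_mem_range_succ n)).trans
      (Nat.le_add_left _ _)
  have hstep (n : ℕ) (b : Fin s → A) (hb : φ b - x ∈ m ^ μ n) :
      ∃ c, φ c - x ∈ m ^ μ (n + 1) ∧ ∀ i, c i - b i ∈ m ^ n := by
    have hμ' : μ n ≤ μ (n + 1) := by
      simp only [μ, Finset.sum_range_succ _ (n + 1)]
      lia
    obtain ⟨a, ha⟩ := happrox (μ (n + 1))
    have hab : φ (a - b) ∈ m ^ ν n := by
      have := sub_mem (Ideal.pow_le_pow_right hμ' ha) hb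
      rw [sub_sub_sub_cancel_right, ← map_sub] at this
      exact Ideal.pow_le_pow_right (hμ n) this
    obtain ⟨κ, hκ, p, hp, hadd⟩ := Submodule.mem_sup.1 (hν n (μ (n + 1)) hab)
    refine ⟨a - κ, ?_, fun i => ?_⟩
    · rw [map_sub, sub_right_comm]
      exact sub_mem ha hκ
    · have : (a - κ) i - b i = p i := by
        have := congrFun hadd i
        simp only [Pi.add_apply, Pi.sub_apply] at this ⊢
        rw [sub_right_comm, ← this, add_sub_cancel_left]
      rw [this]
      exact hp i trivial
  choose! next hnext hnext' using hstep
  obtain ⟨b₀, hb₀⟩ := happrox (μ 0)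
  let b : ℕ → Fin s → A := fun n => Nat.rec b₀ next n
  have hb (n : ℕ) : φ (b n) - x ∈ m ^ μ n := by
    induction n with
    | zero => exact hb₀
    | succ n ih => exact hnext n (b n) ih
  choose c hc using fun i => h.complete (fun n => b n i) fun n => hnext' n (b n) (hb n) i
  refine ⟨c, sub_eq_zero.1 (h.separated _ fun n => ?_)⟩
  have : φ c - x = φ (c - b n) + (φ (b n) - x) := by
    rw [map_sub, sub_add_sub_cancel]
  rw [this]
  exact add_mem (h.map_mem_pow φ fun i => hc i n)
    (Ideal.pow_le_pow_right (Nat.le_add_right _ _) (hb n))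

end IsCompleteLocalAlgebra

end NCDeform

/-! ### STATEMENT 4
A left ideal `I` of a complete local `k`-algebra `A` is closed in each of the following
cases: (a) `A` is a non-commutative formal power series ring and `I` is finitely generated
as a left ideal; (b) `I` is of finite length as a left `A`-module, i.e. `dim_k I < ∞`. -/
theorem NCDeform.statement4 {k : Type u} [Field k] :
    (∀ (T : Type v) [Ring T] [Algebra k T] (mT : Ideal T) (r : ℕ) (t : Fin r → T),
      IsNCPowerSeriesRing k r T mT t →
      ∀ I : Ideal T, I.FG → IsAdicClosed mT I) ∧
    (∀ (A : Type v) [Ring A] [Algebra k A] (mA : Ideal A),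
      IsCompleteLocalAlgebra k A mA →
      ∀ I : Ideal A, FiniteDimensional k ↥(Submodule.restrictScalars k I) →
        IsAdicClosed mA I) := by
  refine ⟨fun T _ _ mT r t hT I hI => hT.complete.isAdicClosed_of_fg hI,
    fun A _ _ mA hA I hI => hA.isAdicClosed_of_fg ?_⟩
  exact Submodule.FG.of_restrictScalars k (Module.Finite.iff_fg.1 hI)
end

section
/- (Artin–Rees for non-commutative formal power series rings) Let I be a finitely generated left ideal of T = k⟨⟨t_1,…,t_r⟩⟩. Then for every m ≥ 1 there is an integer ℓ ≥ 1 such that m_T^ℓ ∩ I ⊆ m_T^m · I; that is, the relative topology on I induced from the m_T-adic topology of T coincides with the m_T-adic topology of I itself. -/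
/- ## Core A : non-commutative complete local algebras -/

open scoped Pointwise

universe u v w

namespace NCDeform

/-- A descending chain of subspaces stabilizes modulo the kernel of a linear map to an artinian
module. -/
theorem exists_le_sup_ker_of_antitone {R : Type*} [Ring R] {V W : Type*} [AddCommGroup V]
    [Module R V] [AddCommGroup W] [Module R W] [IsArtinian R W] (q : V →ₗ[R] W)
    {U : ℕ → Submodule R V} (hU : Antitone U) :
    ∃ N, ∀ l, N ≤ l → U N ≤ U l ⊔ LinearMap.ker q := by
  obtain ⟨N, hN⟩ := IsArtinian.monotone_stabilizes
    (⟨fun l => OrderDual.toDual ((U l).map q), fun _ _ h => Submodule.map_mono (hU h)⟩ :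
      ℕ →o (Submodule R W)ᵒᵈ)
  refine ⟨N, fun l hl => ?_⟩
  have h : (U N).map q = (U l).map q := hN l hl
  rw [← Submodule.comap_map_eq, ← h]
  exact Submodule.le_comap_map q (U N)

namespace IsCompleteLocalAlgebra

variable {k : Type u} [Field k] {A : Type v} [Ring A] [Algebra k A] {m : Ideal A}

/-- The associated graded pieces `mⁿ / mⁿ⁺¹` are finite-dimensional. -/
theorem exists_fg_pow_le_sup (h : IsCompleteLocalAlgebra k A m) (n : ℕ) :
    ∃ P : Submodule k A, P.FG ∧ P ≤ (m ^ n).restrictScalars k ∧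
      (m ^ n).restrictScalars k ≤ P ⊔ (m ^ (n + 1)).restrictScalars k := by
  have := h.isTwoSided
  induction n with
  | zero =>
    refine ⟨Submodule.span k {1}, Submodule.fg_span_singleton 1, ?_, fun a _ => ?_⟩
    · simp [Submodule.pow_zero]
    · obtain ⟨c, hc⟩ := h.exists_residue a
      refine Submodule.mem_sup.2 ⟨algebraMap k A c, ?_, a - algebraMap k A c, ?_, by abel⟩
      · rw [Algebra.algebraMap_eq_smul_one]
        exact Submodule.smul_mem _ _ (Submodule.mem_span_singleton_self 1)
      · simpa [Submodule.pow_one] using hc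
  | succ n ih =>
    obtain ⟨P, hfg, hP, hle⟩ := ih
    obtain ⟨s, hs, hspan⟩ := h.finite_cotangent
    have hsm : Submodule.span k (s : Set A) ≤ m.restrictScalars k := Submodule.span_le.2 hs
    refine ⟨P * Submodule.span k (s : Set A), hfg.mul (Submodule.fg_span s.finite_toSet),
      Submodule.mul_le.2 fun a ha b hb => ?_, fun x hx => ?_⟩
    · rw [Submodule.restrictScalars_mem, Submodule.pow_succ]
      exact Ideal.mul_mem_mul (hP ha) (hsm hb)
    · rw [Submodule.restrictScalars_mem, Submodule.pow_succ] at hx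
      refine Submodule.mul_induction_on hx (fun a ha b hb => ?_) fun _ _ => add_mem
      obtain ⟨p, hp, a', ha', rfl⟩ := Submodule.mem_sup.1 (hle ha)
      obtain ⟨e, he, b', hb', rfl⟩ := Submodule.mem_sup.1 (hspan b hb)
      refine Submodule.mem_sup.2 ⟨p * e, Submodule.mul_mem_mul hp he,
        p * b' + a' * (e + b'), ?_, by noncomm_ring⟩
      refine add_mem ?_ ?_
      · rw [Submodule.restrictScalars_mem, add_assoc, Ideal.IsTwoSided.pow_add]
        exact Ideal.mul_mem_mul (hP hp) hb'
      · rw [Submodule.restrictScalars_mem, Submodule.pow_succ]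
        exact Ideal.mul_mem_mul ha' hb

theorem finite_quotient_pow (h : IsCompleteLocalAlgebra k A m) (n : ℕ) :
    Module.Finite k (A ⧸ (m ^ n).restrictScalars k) := by
  obtain ⟨P, hfg, hP⟩ : ∃ P : Submodule k A, P.FG ∧ P ⊔ (m ^ n).restrictScalars k = ⊤ := by
    induction n with
    | zero => exact ⟨⊥, Submodule.fg_bot, by simp [Submodule.pow_zero]⟩
    | succ n ih =>
      obtain ⟨P, hfg, hP⟩ := ih
      obtain ⟨Q, hQfg, -, hQ⟩ := h.exists_fg_pow_le_sup n
      refine ⟨P ⊔ Q, hfg.sup hQfg, ?_⟩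
      rw [eq_top_iff, ← hP, sup_assoc]
      exact sup_le_sup_left hQ P
  refine ⟨?_⟩
  have hmap := congrArg (Submodule.map ((m ^ n).restrictScalars k).mkQ) hP
  rw [Submodule.map_sup, Submodule.map_top, Submodule.range_mkQ, Submodule.mkQ_map_self,
    sup_bot_eq] at hmap
  exact hmap ▸ hfg.map _

/-- The Artin–Rees property for finitely generated left ideals of a complete local algebra. -/
theorem exists_pow_inf_le_pow_smul (h : IsCompleteLocalAlgebra k A m) {I : Ideal A}
    (hI : I.FG) (d : ℕ) : ∃ l : ℕ, 1 ≤ l ∧ (m ^ l ⊓ I : Ideal A) ≤ (m ^ d) • I := by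
  have := h.isTwoSided
  have hanti : Antitone (fun n : ℕ => m ^ n) := fun _ _ hab => Ideal.pow_le_pow_right hab
  obtain ⟨n, x, rfl⟩ := Submodule.fg_iff_exists_fin_generating_family.1 hI
  let φ : (Fin n → A) →ₗ[A] A := Fintype.linearCombination A x
  have hφ (v : Fin n → A) : φ v = ∑ i, v i * x i := by
    simp [φ, Fintype.linearCombination_apply]
  let U (l : ℕ) : Submodule k (Fin n → A) := (Submodule.comap φ (m ^ l)).restrictScalars k
  have hU : Antitone U := fun a b hab v hv => hanti hab hv
  have hstab (j : ℕ) : ∃ N, ∀ l, N ≤ l → ∀ v ∈ U N, ∃ w ∈ U l, ∀ i, v i - w i ∈ m ^ j := by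
    have := h.finite_quotient_pow j
    obtain ⟨N, hN⟩ := exists_le_sup_ker_of_antitone
      (((m ^ j).restrictScalars k).mkQ.compLeft (Fin n)) hU
    refine ⟨N, fun l hl v hv => ?_⟩
    obtain ⟨w, hw, y, hy, rfl⟩ := Submodule.mem_sup.1 (hN l hl hv)
    refine ⟨w, hw, fun i => ?_⟩
    have hyi := congrFun (LinearMap.mem_ker.1 hy) i
    simpa using (Submodule.Quotient.mk_eq_zero _).1 hyi
  choose N hN using hstab
  let L (j : ℕ) : ℕ := j + 1 + ∑ i ∈ Finset.range (j + 1), N i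
  have hLmono : Monotone L := fun a b hab => by
    have : ∑ i ∈ Finset.range (a + 1), N i ≤ ∑ i ∈ Finset.range (b + 1), N i :=
      Finset.sum_le_sum_of_subset (Finset.range_mono (by omega))
    simp only [L]
    omega
  have hNL (j : ℕ) : N j ≤ L j :=
    (Finset.single_le_sum (f := N) (fun _ _ => Nat.zero_le _)
      (Finset.self_mem_range_succ j)).trans (Nat.le_add_left _ _)
  have hstep (j : ℕ) (v : Fin n → A) (hv : v ∈ U (L j)) :
      ∃ w ∈ U (L (j + 1)), ∀ i, v i - w i ∈ m ^ j :=
    hN j _ ((hNL j).trans (hLmono j.le_succ)) v (hU (hNL j) hv)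
  choose! g hgU hg using hstep
  refine ⟨L d, by simp only [L]; omega, ?_⟩
  rintro y ⟨hy, hyI⟩
  rw [SetLike.mem_coe, ← Fintype.range_linearCombination A] at hyI
  obtain ⟨v, rfl⟩ := hyI
  let s (i : ℕ) : Fin n → A := Nat.rec v (fun i w => g (d + i) w) i
  have hsU (i : ℕ) : s i ∈ U (L (d + i)) := by
    induction i with
    | zero => exact hy
    | succ i ih => exact hgU (d + i) (s i) ih
  have hs (i : ℕ) (a : Fin n) : s i a - s (i + 1) a ∈ m ^ (d + i) := hg (d + i) (s i) (hsU i) a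
  have hvs (i : ℕ) (a : Fin n) : v a - s i a ∈ m ^ d := by
    induction i with
    | zero => simp [s]
    | succ i ih => simpa using add_mem ih (hanti (Nat.le_add_right d i) (hs i a))
  have hlim (a : Fin n) : ∃ z : A, ∀ i, z - s i a ∈ m ^ i :=
    h.complete (fun i => s i a) fun i => by
      rw [← neg_mem_iff, neg_sub]
      exact hanti (Nat.le_add_left i d) (hs i a)
  choose z hz using hlim
  have hφz : φ z = 0 := h.separated _ fun i => by
    have hdiff : φ (z - s i) ∈ m ^ i := by
      rw [hφ]
      exact sum_mem fun a _ => Ideal.mul_mem_right _ _ (hz a i)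
    have hsi : φ (s i) ∈ m ^ i := hanti (by simp only [L]; omega) (hsU i)
    simpa using add_mem hdiff hsi
  have hvz : φ v = ∑ a, (v a - z a) * x a := by
    rw [← sub_zero (φ v), ← hφz, ← map_sub, hφ]
    rfl
  change φ v ∈ _
  rw [hvz]
  refine sum_mem fun a _ =>
    Submodule.smul_mem_smul ?_ (Submodule.subset_span (Set.mem_range_self a))
  simpa using sub_mem (hvs d a) (hz a d)

end IsCompleteLocalAlgebra

end NCDeform

/-! ### STATEMENT 5  (Artin–Rees for non-commutative formal power series rings)
Let `I` be a finitely generated left ideal of `T = k⟪t₁,…,t_r⟫`.  Then for every `m ≥ 1`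
there is `ℓ ≥ 1` with `m_T^ℓ ∩ I ⊆ m_T^m · I`; that is, the relative topology on `I`
induced from the `m_T`-adic topology of `T` coincides with the `m_T`-adic topology of `I`
itself. -/
theorem NCDeform.statement5 {k : Type u} [Field k] {T : Type v} [Ring T] [Algebra k T]
    {r : ℕ} (mT : Ideal T) (t : Fin r → T) (hT : IsNCPowerSeriesRing k r T mT t)
    (I : Ideal T) (hfg : I.FG) :
    ∀ m : ℕ, 1 ≤ m → ∃ l : ℕ, 1 ≤ l ∧ (mT ^ l ⊓ I : Ideal T) ≤ (mT ^ m) • I :=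
  fun d _ => hT.complete.exists_pow_inf_le_pow_smul hfg d
end

section
/- Let A be a complete local k-algebra, I a closed two-sided ideal of A, and S a subset of I. If the image of S spans the k-vector space I / closure(m_A·I + I·m_A), then I is analytically generated by S. Conversely, if S is a finite set and I is analytically generated by S, then the image of S spans I / closure(m_A·I + I·m_A) as a k-vector space. -/
/- ## Core A : non-commutative complete local algebras -/

open scoped Pointwise

universe u v w

namespace NCDeform

/-- Adding a finite-dimensional subspace commutes with decreasing intersections of subspaces. -/
theorem mem_sup_iInf_of_antitone {k : Type u} [Field k] {M : Type v} [AddCommGroup M] [Module k M]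
    (V : Submodule k M) [FiniteDimensional k V] {W : ℕ → Submodule k M} (hW : Antitone W) {x : M}
    (hx : ∀ n, x ∈ V ⊔ W n) : x ∈ V ⊔ ⨅ n, W n := by
  obtain ⟨N, hN⟩ := IsArtinian.monotone_stabilizes (R := k) (M := V)
    ⟨fun n => OrderDual.toDual ((W n).comap V.subtype),
      fun i j hij => Submodule.comap_mono (hW hij)⟩
  have hstable : ∀ n, N ≤ n → ∀ v ∈ V, v ∈ W N → v ∈ W n := by
    intro n hn v hv hvN
    have h : (W N).comap V.subtype = (W n).comap V.subtype := hN n hn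
    have hmem : (⟨v, hv⟩ : V) ∈ (W N).comap V.subtype := hvN
    rw [h] at hmem
    exact hmem
  obtain ⟨v, hv, y, hy, rfl⟩ := Submodule.mem_sup.1 (hx N)
  refine Submodule.add_mem_sup hv ((Submodule.mem_iInf _).2 fun n => ?_)
  rcases le_total n N with hn | hn
  · exact hW hn hy
  obtain ⟨v', hv', y', hy', h⟩ := Submodule.mem_sup.1 (hx n)
  have hdiff : v' - v = y - y' := by
    rw [sub_eq_sub_iff_add_eq_add, h, add_comm]
  have hmem : v' - v ∈ W n := hstable n hn _ (V.sub_mem hv' hv)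
    (hdiff ▸ (W N).sub_mem hy (hW hn hy'))
  have hy_eq : y = v' - v + y' := by rw [hdiff, sub_add_cancel]
  exact hy_eq ▸ (W n).add_mem hmem hy'

section Ring

variable {A : Type v} [Ring A]

theorem adicClosure_mono (m : Ideal A) {I J : Ideal A} (h : I ≤ J) :
    adicClosure m I ≤ adicClosure m J :=
  iInf_mono fun _ => sup_le_sup_right h _

theorem subset_twoSidedSpan (S : Set A) : S ⊆ twoSidedSpan S := fun s hs =>
  Ideal.subset_span ⟨1, s, hs, 1, by simp⟩

theorem twoSidedSpan_le {S : Set A} {I : Ideal A} (hI : ∀ x ∈ I, ∀ a : A, x * a ∈ I)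
    (hS : S ⊆ (I : Set A)) : twoSidedSpan S ≤ I := by
  refine Ideal.span_le.2 ?_
  rintro _ ⟨a, s, hs, b, rfl⟩
  exact hI _ (I.mul_mem_left a (hS hs)) b

theorem mul_mem_twoSidedSpan {S : Set A} {x : A} (hx : x ∈ twoSidedSpan S) (c : A) :
    x * c ∈ twoSidedSpan S := by
  induction hx using Submodule.span_induction with
  | mem x hx =>
    obtain ⟨a, s, hs, b, rfl⟩ := hx
    exact Ideal.subset_span ⟨a, s, hs, b * c, by simp only [mul_assoc]⟩
  | zero => simp
  | add x y _ _ hx hy => rw [add_mul]; exact add_mem hx hy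
  | smul a x _ hx => rw [smul_eq_mul, mul_assoc]; exact Ideal.mul_mem_left _ a hx

/-- A Nakayama-type statement: if `I` is generated by a two-sided ideal `J` modulo `mI + Im`
in the `m`-adic topology, then `J` is `m`-adically dense in `I`. -/
theorem le_adicClosure_of_le_sup {m I J : Ideal A} [m.IsTwoSided]
    (hJ : ∀ x ∈ J, ∀ a : A, x * a ∈ J)
    (h : I ≤ J ⊔ adicClosure m (m • I ⊔ I • m)) : I ≤ adicClosure m J := by
  refine le_iInf fun n => ?_
  induction n with
  | zero => rw [Submodule.pow_zero, Ideal.one_eq_top, sup_top_eq]; exact le_top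
  | succ n ih =>
    refine h.trans (sup_le le_sup_left ((iInf_le _ (n + 1)).trans
      (sup_le (sup_le ?_ ?_) le_sup_right)))
    · refine Submodule.smul_le.2 fun a ha x hx => ?_
      obtain ⟨y, hy, z, hz, rfl⟩ := Submodule.mem_sup.1 (ih hx)
      rw [smul_add]
      refine Submodule.add_mem_sup (J.mul_mem_left a hy) ?_
      rw [Ideal.IsTwoSided.pow_succ]
      exact Submodule.smul_mem_smul ha hz
    · refine Submodule.smul_le.2 fun x hx a ha => ?_
      obtain ⟨y, hy, z, hz, rfl⟩ := Submodule.mem_sup.1 (ih hx)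
      rw [add_smul]
      refine Submodule.add_mem_sup (hJ y hy a) ?_
      rw [Submodule.pow_succ]
      exact Submodule.smul_mem_smul hz ha

end Ring

/-- Modulo `mI + Im`, the two-sided ideal generated by `S` is the linear span of `S`. -/
theorem twoSidedSpan_le_span_sup {k : Type u} [Field k] {A : Type v} [Ring A] [Algebra k A]
    {m I : Ideal A} (hres : ∀ a : A, ∃ c : k, a - algebraMap k A c ∈ m)
    (hI : ∀ x ∈ I, ∀ a : A, x * a ∈ I) {S : Set A} (hSI : S ⊆ (I : Set A)) :
    (twoSidedSpan S).restrictScalars k ≤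
      Submodule.span k S ⊔ (m • I ⊔ I • m).restrictScalars k := by
  have hleft : ∀ x ∈ I, ∀ a ∈ m, a * x ∈ m • I ⊔ I • m := fun x hx a ha =>
    Submodule.mem_sup_left (Submodule.smul_mem_smul ha hx)
  have hright : ∀ x ∈ I, ∀ b ∈ m, x * b ∈ m • I ⊔ I • m := fun x hx b hb =>
    Submodule.mem_sup_right (Submodule.smul_mem_smul hx hb)
  have hle : twoSidedSpan S ≤ I := twoSidedSpan_le hI hSI
  intro x hx
  have hxJ : x ∈ twoSidedSpan S := hx
  clear hx
  induction hxJ using Submodule.span_induction with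
  | mem x hx =>
    obtain ⟨a, s, hs, b, rfl⟩ := hx
    obtain ⟨c, hc⟩ := hres a
    obtain ⟨d, hd⟩ := hres b
    have key : a * s * b = (c * d) • s +
        ((a - algebraMap k A c) * (s * b) + (c • s) * (b - algebraMap k A d)) := by
      simp only [Algebra.algebraMap_eq_smul_one, sub_mul, mul_sub, smul_mul_assoc, one_mul,
        mul_smul_comm, mul_one, smul_smul, mul_assoc, mul_comm c d]
      abel
    rw [key]
    refine Submodule.add_mem_sup (Submodule.smul_mem _ _ (Submodule.subset_span hs)) ?_
    exact add_mem (hleft _ (hI _ (hSI hs) b) _ hc)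
      (hright _ ((I.restrictScalars k).smul_mem c (hSI hs)) _ hd)
  | zero => exact zero_mem _
  | add x y _ _ hx hy => exact add_mem hx hy
  | smul a x hxS hx =>
    obtain ⟨c, hc⟩ := hres a
    have key : a • x = c • x + (a - algebraMap k A c) * x := by
      rw [sub_mul, Algebra.smul_def, smul_eq_mul, add_sub_cancel]
    rw [key]
    exact add_mem (Submodule.smul_mem _ c hx)
      (Submodule.mem_sup_right (hleft x (hle hxS) _ hc))

end NCDeform

/-! ### STATEMENT 6
Let `A` be a complete local `k`-algebra, `I` a closed two-sided ideal of `A` and `S ⊆ I`.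
If the image of `S` spans `I / closure(m_A·I + I·m_A)` over `k` then `I` is analytically
generated by `S` (i.e. `I` is the closure of the two-sided ideal generated by `S`);
conversely, if `S` is finite and `I` is analytically generated by `S`, then the image of
`S` spans `I / closure(m_A·I + I·m_A)` as a `k`-vector space. -/
theorem NCDeform.statement6 {k : Type u} [Field k] {A : Type v} [Ring A] [Algebra k A]
    (mA : Ideal A) (hA : IsCompleteLocalAlgebra k A mA)
    (I : Ideal A) (hItwo : ∀ x ∈ I, ∀ a : A, x * a ∈ I) (hIclosed : IsAdicClosed mA I)
    (S : Set A) (hSI : S ⊆ (I : Set A)) :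
    ((∀ x ∈ I, x ∈ Submodule.span k S ⊔
        Submodule.restrictScalars k (adicClosure mA (mA • I ⊔ I • (mA : Ideal A)))) →
      I = adicClosure mA (twoSidedSpan S)) ∧
    (S.Finite → I = adicClosure mA (twoSidedSpan S) →
      ∀ x ∈ I, x ∈ Submodule.span k S ⊔
        Submodule.restrictScalars k (adicClosure mA (mA • I ⊔ I • (mA : Ideal A)))) := by
  have : mA.IsTwoSided := ⟨fun a hx => hA.mul_mem_right _ hx a⟩
  constructor
  · intro h
    refine le_antisymm (le_adicClosure_of_le_sup (fun _ hx => mul_mem_twoSidedSpan hx) ?_) ?_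
    · intro x hx
      obtain ⟨y, hy, z, hz, rfl⟩ := Submodule.mem_sup.1 (h x hx)
      have hle : Submodule.span k S ≤ (twoSidedSpan S).restrictScalars k :=
        Submodule.span_le.2 (subset_twoSidedSpan S)
      exact Submodule.add_mem_sup (hle hy) hz
    · exact (adicClosure_mono mA (twoSidedSpan_le hItwo hSI)).trans hIclosed.ge
  · intro hS hgen x hx
    have : FiniteDimensional k (Submodule.span k S) := FiniteDimensional.span_of_finite k hS
    have hW : Antitone fun n : ℕ =>
        ((mA • I ⊔ I • mA) ⊔ mA ^ n).restrictScalars k := fun i j hij =>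
      (sup_le_sup_left (Ideal.pow_le_pow_right hij) _ : (mA • I ⊔ I • mA) ⊔ mA ^ j ≤ _)
    have hmem := mem_sup_iInf_of_antitone (Submodule.span k S) hW (x := x) fun n => by
      have hxn : x ∈ twoSidedSpan S ⊔ mA ^ n := (Submodule.mem_iInf _).1 (hgen.le hx) n
      obtain ⟨y, hy, z, hz, rfl⟩ := Submodule.mem_sup.1 hxn
      obtain ⟨v, hv, w, hw, rfl⟩ := Submodule.mem_sup.1
        (twoSidedSpan_le_span_sup hA.exists_residue hItwo hSI hy)
      rw [add_assoc]
      exact Submodule.add_mem_sup hv (Submodule.add_mem_sup (R := A) hw hz)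
    obtain ⟨y, hy, z, hz, rfl⟩ := Submodule.mem_sup.1 hmem
    exact Submodule.add_mem_sup hy
      ((Submodule.mem_iInf _).2 fun n => (Submodule.mem_iInf _).1 hz n)
end
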